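/- arXiv:math-ph/0703022 — 5 statements merged into one kernel-verified Lean document; each statement's English description precedes it below -/
import Mathlib

section
/- Let m ≥ 1 and let a, α, d₀, p be positive real numbers with a > 2α. Then there exists ρ₀ > 0 such that for all ρ ≥ ρ₀ and all vectors β, β', τ, β₁ ∈ ℝ^m satisfying ‖τ‖ ≤ d₀, ‖β − β'‖ < ρ^{a−2α}, 0 < ‖β₁‖ < p·ρ^α, and |‖β+β₁+τ‖² − ‖β+τ‖²| > (8/9)·ρ^a, one has |‖β'+τ‖² − ‖β'+β₁+τ‖²| > (7/8)·ρ^a. -/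
/-- The increment of `‖·‖ ^ 2` along `v` at two base points differs by twice an inner product. -/
theorem norm_add_sq_sub_norm_sq_sub {E : Type*} [NormedAddCommGroup E] [InnerProductSpace ℝ E]
    (x y v : E) :
    (‖x + v‖ ^ 2 - ‖x‖ ^ 2) - (‖y + v‖ ^ 2 - ‖y‖ ^ 2) = 2 * inner ℝ (x - y) v := by
  rw [norm_add_sq_real, norm_add_sq_real, inner_sub_left]
  ring

/-- persistence of the quadratic non-resonance gap under perturbation of the
center (inequality (100) in the proof of Lemma 3). -/
theorem stmt_2 (m : ℕ) (hm : 1 ≤ m) (a α d₀ p : ℝ)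
    (ha : 0 < a) (hα : 0 < α) (hd₀ : 0 < d₀) (hp : 0 < p) (haα : 2 * α < a) :
    ∃ ρ₀ > 0, ∀ ρ : ℝ, ρ₀ ≤ ρ →
      ∀ β β' τ β₁ : EuclideanSpace ℝ (Fin m),
        ‖τ‖ ≤ d₀ → ‖β - β'‖ < ρ ^ (a - 2 * α) →
        0 < ‖β₁‖ → ‖β₁‖ < p * ρ ^ α →
        (8 / 9) * ρ ^ a < |‖β + β₁ + τ‖ ^ 2 - ‖β + τ‖ ^ 2| →
        (7 / 8) * ρ ^ a < |‖β' + τ‖ ^ 2 - ‖β' + β₁ + τ‖ ^ 2| := by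
  have hρ₀ : 0 < (144 * p) ^ α⁻¹ := by positivity
  refine ⟨(144 * p) ^ α⁻¹, hρ₀, fun ρ hρ β β' τ β₁ _ hβ _ hβ₁ hgap => ?_⟩
  have hρpos : 0 < ρ := hρ₀.trans_le hρ
  have hlarge : 144 * p ≤ ρ ^ α :=
    (Real.rpow_inv_le_iff_of_pos (by positivity) hρpos.le hα).1 hρ
  have hsplit : ρ ^ a = ρ ^ (a - 2 * α) * (ρ ^ α * ρ ^ α) := by
    rw [← Real.rpow_add hρpos, ← Real.rpow_add hρpos]
    ring_nf
  have hinner : |inner ℝ (β - β') β₁| ≤ ρ ^ (a - 2 * α) * (p * ρ ^ α) :=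
    (abs_real_inner_le_norm _ _).trans (by gcongr)
  have hsmall : 144 * (ρ ^ (a - 2 * α) * (p * ρ ^ α)) ≤ ρ ^ a := by
    calc 144 * (ρ ^ (a - 2 * α) * (p * ρ ^ α))
        = ρ ^ (a - 2 * α) * (144 * p * ρ ^ α) := by ring
      _ ≤ ρ ^ (a - 2 * α) * (ρ ^ α * ρ ^ α) := by gcongr
      _ = ρ ^ a := hsplit.symm
  have hdiff := norm_add_sq_sub_norm_sq_sub (β + τ) (β' + τ) β₁
  rw [add_sub_add_right_eq_sub, add_right_comm β, add_right_comm β'] at hdiff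
  rw [abs_sub_comm]
  have htri := abs_sub_abs_le_abs_sub (‖β + β₁ + τ‖ ^ 2 - ‖β + τ‖ ^ 2)
    (‖β' + β₁ + τ‖ ^ 2 - ‖β' + τ‖ ^ 2)
  rw [hdiff, abs_mul, abs_two] at htri
  linarith
end

section
/- Let m ≥ 1 and let α, a be real numbers with 0 < 4α < a < 1. Then there exists ρ₀ > 0 such that for all ρ ≥ ρ₀ and all u, w ∈ ℝ^m satisfying ρ/2 < ‖u‖ < 3ρ/2, ‖w‖ ≤ ‖u‖ + (1/9)·ρ^{a−1}, and ‖u − w‖ ≥ ρ^{a−2α}, one has ⟨u,w⟩ ≤ ‖u‖² − (1/3)·ρ^{2a−4α}. -/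
open scoped RealInnerProductSpace

/-- case i = 3 of estimate (103) in the proof of Lemma 3. -/
theorem stmt_3 (m : ℕ) (hm : 1 ≤ m) (α a : ℝ)
    (hα : 0 < α) (h4 : 4 * α < a) (h1 : a < 1) :
    ∃ ρ₀ > 0, ∀ ρ : ℝ, ρ₀ ≤ ρ →
      ∀ u w : EuclideanSpace ℝ (Fin m),
        ρ / 2 < ‖u‖ → ‖u‖ < 3 * ρ / 2 →
        ‖w‖ ≤ ‖u‖ + (1 / 9) * ρ ^ (a - 1) →
        ρ ^ (a - 2 * α) ≤ ‖u - w‖ →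
        ⟪u, w⟫ ≤ ‖u‖ ^ 2 - (1 / 3) * ρ ^ (2 * a - 4 * α) := by
  obtain ⟨R, hR⟩ := Filter.eventually_atTop.1
    ((tendsto_rpow_atTop (sub_pos.2 h4)).eventually_ge_atTop 2)
  refine ⟨max 1 R, by positivity, fun ρ hρ u w _ hu hw huw => ?_⟩
  have hρ1 : 1 ≤ ρ := (le_max_left _ _).trans hρ
  have hρ0 : 0 < ρ := by linarith
  have h2 : 2 ≤ ρ ^ (a - 4 * α) := hR ρ ((le_max_right _ _).trans hρ)
  have ha : 1 ≤ ρ ^ a := Real.one_le_rpow hρ1 (by linarith)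
  have hε : ρ ^ (a - 1) ≤ 1 := Real.rpow_le_one_of_one_le_of_nonpos hρ1 (by linarith)
  have hε0 : 0 < ρ ^ (a - 1) := Real.rpow_pos_of_pos hρ0 _
  have hmul : ρ * ρ ^ (a - 1) = ρ ^ a := by
    rw [Real.rpow_sub_one hρ0.ne']
    field_simp
  have hX : ρ ^ (2 * a - 4 * α) = ρ ^ a * ρ ^ (a - 4 * α) := by
    rw [← Real.rpow_add hρ0]
    ring_nf
  have hD : ρ ^ (2 * a - 4 * α) = (ρ ^ (a - 2 * α)) ^ 2 := by
    rw [← Real.rpow_mul_natCast hρ0.le]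
    ring_nf
  have hX2 : ρ ^ a * 2 ≤ ρ ^ (2 * a - 4 * α) := by
    rw [hX]
    gcongr
  have hD2 : ρ ^ (2 * a - 4 * α) ≤ ‖u - w‖ ^ 2 := by
    rw [hD]
    gcongr
  have hw2 : ‖w‖ ^ 2 ≤ (‖u‖ + (1 / 9) * ρ ^ (a - 1)) ^ 2 := by gcongr
  have hcross : ‖u‖ * ρ ^ (a - 1) ≤ 3 * ρ / 2 * ρ ^ (a - 1) := by gcongr
  have hsq : ρ ^ (a - 1) * ρ ^ (a - 1) ≤ 1 :=
    mul_le_one₀ hε hε0.le hε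
  have hcos := norm_sub_sq_real u w
  nlinarith
end

section
/- Let m ≥ 1, let d₀ > 0, and let α_d be a real number with 0 < α_d < 1/4. Then there exists ρ₀ > 0 such that for all ρ ≥ ρ₀ the following holds: if β, τ, b ∈ ℝ^m satisfy ‖τ‖ ≤ d₀, ‖β+τ‖ ≤ 3ρ/2, 0 < ‖b‖ < ρ^{α_d}, and |‖β+b‖² − ‖β‖²| ≥ ρ^{1/2}, then |‖β+b+τ‖² − ‖β+τ‖²| > (1/2)·ρ^{1/2}; in particular, ‖β+b+τ‖ does not lie in the interval [‖β+τ‖ − ρ^{2α_d−1}, ‖β+τ‖ + ρ^{α_d−1}]. -/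
/-- the annulus condition defining the set A₆ in the proof of Lemma 3
excludes all translates β + b with 0 < ‖b‖ < ρ^{α_d} avoiding the resonance slab. -/
theorem stmt_5 (m : ℕ) (hm : 1 ≤ m) (d₀ : ℝ) (hd₀ : 0 < d₀)
    (αd : ℝ) (h0 : 0 < αd) (h1 : αd < 1 / 4) :
    ∃ ρ₀ > 0, ∀ ρ : ℝ, ρ₀ ≤ ρ →
      ∀ β τ b : EuclideanSpace ℝ (Fin m),
        ‖τ‖ ≤ d₀ → ‖β + τ‖ ≤ 3 * ρ / 2 →
        0 < ‖b‖ → ‖b‖ < ρ ^ αd →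
        ρ ^ ((1 : ℝ) / 2) ≤ |‖β + b‖ ^ 2 - ‖β‖ ^ 2| →
        (1 / 2) * ρ ^ ((1 : ℝ) / 2) < |‖β + b + τ‖ ^ 2 - ‖β + τ‖ ^ 2| ∧
          ¬(‖β + τ‖ - ρ ^ (2 * αd - 1) ≤ ‖β + b + τ‖ ∧
            ‖β + b + τ‖ ≤ ‖β + τ‖ + ρ ^ (αd - 1)) := by
  obtain ⟨ρ₁, hρ₁⟩ := Filter.eventually_atTop.1
    ((tendsto_rpow_atTop (show 0 < 1 / 2 - 2 * αd by linarith)).eventually_ge_atTop (9 + 4 * d₀))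
  refine ⟨max ρ₁ 1, by positivity, fun ρ hρ β τ b hτ hβ hb hbρ hres => ?_⟩
  have hρ1 : 1 ≤ ρ := (le_max_right _ _).trans hρ
  have hρ0 : 0 < ρ := by linarith
  have hle : ρ ^ αd ≤ ρ ^ (2 * αd) := Real.rpow_le_rpow_of_exponent_le hρ1 (by linarith)
  have hone : 1 ≤ ρ ^ (2 * αd) := Real.one_le_rpow hρ1 (by linarith)
  have hbig : (9 + 4 * d₀) * ρ ^ (2 * αd) ≤ ρ ^ ((1 : ℝ) / 2) := by
    have h := mul_le_mul_of_nonneg_right (hρ₁ ρ ((le_max_left _ _).trans hρ))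
      (zero_le_one.trans hone)
    rwa [← Real.rpow_add hρ0, sub_add_cancel] at h
  have hdiff : (1 / 2) * ρ ^ ((1 : ℝ) / 2) < |‖β + b + τ‖ ^ 2 - ‖β + τ‖ ^ 2| := by
    have hshift : ‖β + b + τ‖ ^ 2 - ‖β + τ‖ ^ 2
        = (‖β + b‖ ^ 2 - ‖β‖ ^ 2) + 2 * inner ℝ b τ := by
      rw [norm_add_sq_real (β + b) τ, norm_add_sq_real β τ, inner_add_left]
      ring
    have hinner : |2 * inner ℝ b τ| ≤ 2 * (d₀ * ρ ^ (2 * αd)) := by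
      rw [abs_mul, abs_two]
      have h := mul_le_mul (hbρ.le.trans hle) hτ (norm_nonneg τ) (zero_le_one.trans hone)
      linarith [abs_real_inner_le_norm b τ]
    have htri := abs_sub (‖β + b + τ‖ ^ 2 - ‖β + τ‖ ^ 2) (2 * inner ℝ b τ)
    rw [hshift, add_sub_cancel_right, ← hshift] at htri
    linarith
  refine ⟨hdiff, fun ⟨hlow, hupp⟩ => hdiff.not_ge ?_⟩
  have he : ρ * ρ ^ (αd - 1) = ρ ^ αd := by
    rw [← Real.rpow_one_add' hρ0.le (by linarith)]
    ring_nf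
  have hf : ρ * ρ ^ (2 * αd - 1) = ρ ^ (2 * αd) := by
    rw [← Real.rpow_one_add' hρ0.le (by linarith)]
    ring_nf
  have he0 : 0 < ρ ^ (αd - 1) := Real.rpow_pos_of_pos hρ0 _
  have he1 : ρ ^ (αd - 1) ≤ 1 := Real.rpow_le_one_of_one_le_of_nonpos hρ1 (by linarith)
  have hf0 : 0 < ρ ^ (2 * αd - 1) := Real.rpow_pos_of_pos hρ0 _
  have hd : 0 < d₀ * ρ ^ (2 * αd) := by positivity
  have hs := norm_nonneg (β + b + τ)
  generalize ‖β + b + τ‖ = s at *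
  have hR := norm_nonneg (β + τ)
  generalize ‖β + τ‖ = R at *
  generalize ρ ^ (αd - 1) = e at *
  generalize ρ ^ (2 * αd - 1) = f at *
  rw [abs_le]
  constructor
  · rcases le_or_gt R s with h | h
    · nlinarith
    · nlinarith [mul_le_mul_of_nonneg_left hβ hf0.le, sq_nonneg (R - s)]
  · have hsq : s ^ 2 ≤ (R + e) ^ 2 := pow_le_pow_left₀ hs hupp 2
    nlinarith [mul_le_mul_of_nonneg_left hβ he0.le]
end

section
/- For every m ≥ 2 there exists a constant C_m > 0 such that for all linearly independent vectors u, v ∈ ℝ^m, all c₁, c₂ ∈ ℝ, and all ε₁, ε₂ > 0, R > 0, the Lebesgue measure of the set {x ∈ ℝ^m : ‖x‖ < R, |⟨x,u⟩ − c₁| < ε₁, and |⟨x,v⟩ − c₂| < ε₂} is at most C_m · ε₁ · ε₂ · R^{m−2} / (‖u‖ · ‖v − (⟨v,u⟩/‖u‖²)u‖). -/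
open scoped RealInnerProductSpace

section DoubleSlab

/-- Two orthonormal vectors are the first two members of some orthonormal basis. -/
theorem exists_orthonormalBasis_zero_one {n : ℕ} {a b : EuclideanSpace ℝ (Fin (n + 2))}
    (ha : ‖a‖ = 1) (hb : ‖b‖ = 1) (hab : ⟪a, b⟫ = 0) :
    ∃ B : OrthonormalBasis (Fin (n + 2)) ℝ (EuclideanSpace ℝ (Fin (n + 2))),
      B 0 = a ∧ B 1 = b := by
  have horth : Orthonormal ℝ (({0, 1} : Set (Fin (n + 2))).domRestrict
      (fun i => if i = 0 then a else b)) := by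
    constructor
    · rintro ⟨i, hi⟩
      by_cases h : i = 0 <;> simp [h, ha, hb]
    · rintro ⟨i, hi⟩ ⟨j, hj⟩ hij
      rcases hi with rfl | rfl <;> rcases hj with rfl | rfl <;>
        simp_all [real_inner_comm]
  obtain ⟨B, hB⟩ := horth.exists_orthonormalBasis_extension_of_card_eq (by simp)
  exact ⟨B, by simpa using hB 0 (by simp), by simpa using hB 1 (by simp)⟩

/-- The set of points whose inner products with the vectors `g i` lie in intervals of half-width
`r i` has volume `∏ 2 r i / |det|`, where the determinant is that of the family `g`
expressed in an orthonormal basis. -/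
theorem volume_inner_box_eq {ι : Type*} [Fintype ι] [DecidableEq ι]
    (B : OrthonormalBasis ι ℝ (EuclideanSpace ℝ ι)) (g : ι → EuclideanSpace ℝ ι) (c r : ι → ℝ)
    (hdet : (Matrix.of fun i j => ⟪B j, g i⟫).det ≠ 0) :
    MeasureTheory.volume {x : EuclideanSpace ℝ ι | ∀ i, |⟪x, g i⟫ - c i| < r i} =
      ENNReal.ofReal |(Matrix.of fun i j => ⟪B j, g i⟫).det⁻¹| *
        ∏ i, ENNReal.ofReal (2 * r i) := by
  set A : Matrix ι ι ℝ := Matrix.of fun i j => ⟪B j, g i⟫ with hA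
  have hT : MeasureTheory.MeasurePreserving
      (fun y : ι → ℝ => B.repr.symm (WithLp.toLp 2 y)) :=
    B.measurePreserving_repr_symm.comp (PiLp.volume_preserving_toLp ι)
  have hS : MeasurableSet {x : EuclideanSpace ℝ ι | ∀ i, |⟪x, g i⟫ - c i| < r i} := by
    rw [Set.ofPred_forall]
    exact MeasurableSet.iInter fun i =>
      (isOpen_lt (by fun_prop) continuous_const).measurableSet
  have hpre : (fun y : ι → ℝ => B.repr.symm (WithLp.toLp 2 y)) ⁻¹'
      {x : EuclideanSpace ℝ ι | ∀ i, |⟪x, g i⟫ - c i| < r i} =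
      Matrix.toLin' A ⁻¹' Set.univ.pi fun i => Metric.ball (c i) (r i) := by
    ext y
    have hy (i : ι) : ⟪B.repr.symm (WithLp.toLp 2 y), g i⟫ = (A.mulVec y) i := by
      rw [← B.sum_repr_symm, sum_inner]
      simp [Matrix.mulVec, dotProduct, hA, real_inner_smul_left, mul_comm]
    simp [hy, Real.dist_eq]
  rw [← hT.measure_preimage hS.nullMeasurableSet, hpre,
    MeasureTheory.Measure.addHaar_preimage_linearMap _ (by simpa using hdet),
    MeasureTheory.volume_pi_pi]
  simp [Real.volume_ball]

end DoubleSlab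

/-- double-slab volume estimate in ℝ^m (computation (109)–(110) of Lemma 4). -/
theorem stmt_7 (m : ℕ) (hm : 2 ≤ m) :
    ∃ C > 0, ∀ u v : EuclideanSpace ℝ (Fin m), LinearIndependent ℝ ![u, v] →
      ∀ c₁ c₂ ε₁ ε₂ R : ℝ, 0 < ε₁ → 0 < ε₂ → 0 < R →
        MeasureTheory.volume {x : EuclideanSpace ℝ (Fin m) |
            ‖x‖ < R ∧ |⟪x, u⟫ - c₁| < ε₁ ∧ |⟪x, v⟫ - c₂| < ε₂}
          ≤ ENNReal.ofReal (C * ε₁ * ε₂ * R ^ (m - 2) /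
              (‖u‖ * ‖v - (⟪v, u⟫ / ‖u‖ ^ 2) • u‖)) := by
  obtain ⟨n, rfl⟩ := Nat.exists_eq_add_of_le' hm
  refine ⟨2 ^ (n + 2), by positivity, fun u v huv c₁ c₂ ε₁ ε₂ R h₁ h₂ hR => ?_⟩
  set t : ℝ := ⟪v, u⟫ / ‖u‖ ^ 2 with ht
  set w := v - t • u with hw
  have hu : u ≠ 0 := huv.ne_zero 0
  have hw0 : w ≠ 0 := by
    intro h
    have := (LinearIndependent.pair_iff.1 huv) (-t) 1 (by rw [← h, hw]; module)
    exact one_ne_zero this.2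
  have hun : 0 < ‖u‖ := norm_pos_iff.2 hu
  have hwn : 0 < ‖w‖ := norm_pos_iff.2 hw0
  have huw : ⟪u, w⟫ = 0 := by
    rw [hw, inner_sub_right, real_inner_smul_right, real_inner_self_eq_norm_sq, ht,
      real_inner_comm u v]
    field_simp
    ring
  obtain ⟨B, hB0, hB1⟩ := exists_orthonormalBasis_zero_one
    (a := ‖u‖⁻¹ • u) (b := ‖w‖⁻¹ • w) (norm_smul_inv_norm hu) (norm_smul_inv_norm hw0)
    (by simp [real_inner_smul_left, real_inner_smul_right, huw])
  have hu' : u = ‖u‖ • B 0 := by rw [hB0, smul_inv_smul₀ hun.ne']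
  have hw' : w = ‖w‖ • B 1 := by rw [hB1, smul_inv_smul₀ hwn.ne']
  have hv' : v = (t * ‖u‖) • B 0 + ‖w‖ • B 1 := by
    rw [← hw', mul_smul, ← hu', hw]; abel
  have hBB := B.inner_eq_ite
  let g : Fin (n + 2) → EuclideanSpace ℝ (Fin (n + 2)) :=
    Fin.cons u (Fin.cons v fun k => B k.succ.succ)
  have hgu (j) : ⟪B j, u⟫ = if j = 0 then ‖u‖ else 0 := by
    conv_lhs => rw [hu']
    simp [real_inner_smul_right, hBB]
  have hgv (j) : ⟪B j, v⟫ = (if j = 0 then t * ‖u‖ else 0) + if j = 1 then ‖w‖ else 0 := by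
    conv_lhs => rw [hv']
    simp [inner_add_right, real_inner_smul_right, hBB]
  have hdet : (Matrix.of fun i j => ⟪B j, g i⟫).det = ‖u‖ * ‖w‖ := by
    rw [Matrix.det_of_isLowerTriangular]
    · simp [Fin.prod_univ_succ, g, hgu, hgv]
    · intro i j hij
      replace hij : i < j := hij
      induction i using Fin.cases with
      | zero => simp [g, hgu, hij.ne']
      | succ i =>
        induction i using Fin.cases with
        | zero =>
          have h0 : j ≠ 0 := Fin.ne_zero_of_lt hij
          have h1 : j ≠ 1 := hij.ne'
          simp [g, hgv, h0, h1]
        | succ k => simp [g, hBB, hij.ne']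
  have hsub : {x : EuclideanSpace ℝ (Fin (n + 2)) |
      ‖x‖ < R ∧ |⟪x, u⟫ - c₁| < ε₁ ∧ |⟪x, v⟫ - c₂| < ε₂} ⊆
      {x | ∀ i, |⟪x, g i⟫ - (Fin.cons c₁ (Fin.cons c₂ 0) : Fin (n + 2) → ℝ) i| <
        (Fin.cons ε₁ (Fin.cons ε₂ fun _ => R) : Fin (n + 2) → ℝ) i} := by
    rintro x ⟨hx, hxu, hxv⟩
    simp only [Set.mem_ofPred_eq, Fin.forall_fin_succ (n := n + 1), Fin.forall_fin_succ (n := n), g,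
      Fin.cons_zero, Fin.cons_succ, Pi.zero_apply, sub_zero]
    refine ⟨hxu, hxv, fun k => ?_⟩
    have := abs_real_inner_le_norm x (B k.succ.succ)
    rw [B.norm_eq_one, mul_one] at this
    exact this.trans_lt hx
  refine (MeasureTheory.measure_mono hsub).trans_eq ?_
  rw [volume_inner_box_eq B g _ _ (by rw [hdet]; positivity), hdet, abs_of_pos (by positivity)]
  simp only [Fin.prod_univ_succ, Fin.cons_zero, Fin.cons_succ, Finset.prod_const, Finset.card_univ,
    Fintype.card_fin]
  rw [← ENNReal.ofReal_pow (by positivity), ← ENNReal.ofReal_mul (by positivity),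
    ← ENNReal.ofReal_mul (by positivity), ← ENNReal.ofReal_mul (by positivity)]
  congr 1
  rw [Nat.add_sub_cancel]
  field_simp
  ring
end

section
/- Let c > 0, let Q : ℝ → ℝ be continuous with Q(s+2π) = Q(s) for all s, let μ ∈ ℝ and v ∈ ℝ, and let φ : ℝ → ℂ be twice continuously differentiable and satisfy −c·φ''(s) + Q(s)·φ(s) = μ·φ(s) and φ(s+2π) = e^{2πiv}·φ(s) for all s ∈ ℝ. Then for every nonzero integer k, ∫₀^{2π} e^{iks}·φ'(s)·conj(φ(s)) ds = (k/(2i))·∫₀^{2π} e^{iks}·φ(s)·conj(φ(s)) ds. -/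
open Complex ComplexConjugate

/-- The Wronskian of `φ` and `conj φ`. -/
noncomputable def conjWronskian (φ : ℝ → ℂ) (s : ℝ) : ℂ :=
  deriv φ s * conj (φ s) - φ s * conj (deriv φ s)

lemma hasDerivAt_conjWronskian {φ : ℝ → ℂ} {s q : ℝ} (h : DifferentiableAt ℝ φ s)
    (h' : DifferentiableAt ℝ (deriv φ) s) (hq : deriv (deriv φ) s = q * φ s) :
    HasDerivAt (conjWronskian φ) 0 s := by
  have h₁ := h.hasDerivAt
  have h₂ := h'.hasDerivAt
  refine ((h₂.mul h₁.star).sub (h₁.mul h₂.star)).congr_deriv ?_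
  simp only [hq, ← starRingEnd_apply, map_mul, conj_ofReal]
  ring

lemma deriv_add_const_of_quasiperiodic {φ : ℝ → ℂ} {T : ℝ} {ρ : ℂ}
    (h : ∀ s, φ (s + T) = ρ * φ s) (s : ℝ) : deriv φ (s + T) = ρ * deriv φ s := by
  rw [← deriv_comp_add_const, funext h, deriv_const_mul_field]

lemma quasiperiodic_mul_conj {φ ψ : ℝ → ℂ} {T : ℝ} {ρ : ℂ} (hρ : ρ * conj ρ = 1)
    (hφ : ∀ s, φ (s + T) = ρ * φ s) (hψ : ∀ s, ψ (s + T) = ρ * ψ s) (s : ℝ) :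
    φ (s + T) * conj (ψ (s + T)) = φ s * conj (ψ s) := by
  rw [hφ, hψ, map_mul]
  linear_combination φ s * conj (ψ s) * hρ


/-- the identity (e^{iks}φ', φ) = (k/(2i))(e^{iks}φ, φ) from Appendix C,
for eigenfunctions of the quasi-periodic Sturm–Liouville problem. -/
theorem stmt_18 (c : ℝ) (hc : 0 < c)
    (Q : ℝ → ℝ) (hQ : Continuous Q) (hQper : ∀ s : ℝ, Q (s + 2 * Real.pi) = Q s)
    (μ v : ℝ) (φ : ℝ → ℂ) (hφ : ContDiff ℝ 2 φ)
    (heq : ∀ s : ℝ, -(c : ℂ) * deriv (deriv φ) s + (Q s : ℂ) * φ s = (μ : ℂ) * φ s)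
    (hper : ∀ s : ℝ, φ (s + 2 * Real.pi) =
      Complex.exp (2 * Real.pi * (v : ℂ) * Complex.I) * φ s)
    (k : ℤ) (hk : k ≠ 0) :
    (∫ s in (0 : ℝ)..(2 * Real.pi),
        Complex.exp (Complex.I * (k : ℂ) * (s : ℂ)) * deriv φ s * (starRingEnd ℂ) (φ s))
      = ((k : ℂ) / (2 * Complex.I)) *
        ∫ s in (0 : ℝ)..(2 * Real.pi),
          Complex.exp (Complex.I * (k : ℂ) * (s : ℂ)) * φ s * (starRingEnd ℂ) (φ s) := by
  have hφd : Differentiable ℝ φ := hφ.differentiable (by norm_num)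
  have hφ' : ContDiff ℝ 1 (deriv φ) := (contDiff_succ_iff_deriv.1 hφ).2.2
  have hφd' : Differentiable ℝ (deriv φ) := hφ'.differentiable (by norm_num)
  have hφc := hφ.continuous
  have hφc' := hφ'.continuous
  have hkC : (k : ℂ) ≠ 0 := Int.cast_ne_zero.2 hk
  have hcC : (c : ℂ) ≠ 0 := ofReal_ne_zero.2 hc.ne'
  have hW (s : ℝ) : HasDerivAt (conjWronskian φ) 0 s := by
    refine hasDerivAt_conjWronskian (q := (Q s - μ) / c) (hφd s) (hφd' s) ?_
    push_cast
    field_simp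
    linear_combination -heq s
  have hE (s : ℝ) : HasDerivAt (fun t : ℝ => exp (I * (k : ℂ) * (t : ℂ)))
      (exp (I * (k : ℂ) * (s : ℂ)) * (I * k)) s := by
    have h := ((hasDerivAt_id s).ofReal_comp.const_mul (I * (k : ℂ))).cexp
    simpa using h
  set ρ : ℂ := exp (2 * Real.pi * (v : ℂ) * I) with hρdef
  have hρ : ρ * conj ρ = 1 := by
    rw [hρdef, ← exp_conj, ← exp_add]
    simp [map_ofNat]
  have hper' := deriv_add_const_of_quasiperiodic hper
  have hEper : exp (I * (k : ℂ) * ((2 * Real.pi : ℝ) : ℂ)) = 1 := by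
    rw [← exp_int_mul_two_pi_mul_I k]
    push_cast
    ring_nf
  have hFTC := intervalIntegral.integral_eq_sub_of_hasDerivAt (a := 0) (b := 2 * Real.pi)
    (f := fun s : ℝ => exp (I * (k : ℂ) * (s : ℂ)) *
      (φ s * conj (φ s) / 2 + conjWronskian φ s / (2 * (I * k))))
    (f' := fun s : ℝ => exp (I * (k : ℂ) * (s : ℂ)) * deriv φ s * conj (φ s) -
      (k : ℂ) / (2 * I) * (exp (I * (k : ℂ) * (s : ℂ)) * φ s * conj (φ s)))
    (fun s _ => by
      have h₁ := (hφd s).hasDerivAt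
      refine ((hE s).mul (((h₁.mul h₁.star).div_const 2).add
        ((hW s).div_const (2 * (I * k))))).congr_deriv ?_
      simp only [Pi.mul_apply, Pi.add_apply, conjWronskian, ← starRingEnd_apply]
      field_simp
      ring_nf
      simp only [I_sq]
      ring)
    (Continuous.intervalIntegrable (by fun_prop) _ _)
  have h₀ := quasiperiodic_mul_conj hρ hper hper 0
  have h₁ := quasiperiodic_mul_conj hρ hper' hper 0
  have h₂ := quasiperiodic_mul_conj hρ hper hper' 0
  rw [zero_add] at h₀ h₁ h₂
  rw [intervalIntegral.integral_sub (Continuous.intervalIntegrable (by fun_prop) _ _)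
    (Continuous.intervalIntegrable (by fun_prop) _ _),
    intervalIntegral.integral_const_mul, hEper] at hFTC
  simp only [conjWronskian, h₀, h₁, h₂, ofReal_zero, mul_zero, exp_zero, sub_self] at hFTC
  exact sub_eq_zero.1 hFTC
end
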